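/- For every concept C ∈ L(≥,⊓,⊤)[Σ_C,Σ_R], every interpretation I, and every d ∈ C^I, there exists a sub-interpretation I' ⊆ I with d ∈ Δ^{I'}, d ∈ C^{I'}, and |Δ^{I'}| ≤ |C|^{|C|}. -/

import Mathlib

namespace DL

/-! ### Syntax of ALCQI concepts -/

/-- Roles: role names (indexed by ℕ) and inverse roles. -/
inductive Role where
  | name : ℕ → Role
  | inv  : ℕ → Role
deriving DecidableEq

/-- ALCQI concept expressions. -/
inductive Concept where
  | atom : ℕ → Concept
  | top  : Concept
  | bot  : Concept
  | and  : Concept → Concept → Concept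
  | or   : Concept → Concept → Concept
  | neg  : Concept → Concept
  | ex   : Role → Concept → Concept
  | all  : Role → Concept → Concept
  | atLeast : ℕ → Role → Concept → Concept
deriving DecidableEq

/-- The operators/constructors that a concept language may use. -/
inductive Op where
  | all | ex | ge | inv | and | or | top | bot | neg
deriving DecidableEq

/-! ### Interpretations and semantics -/

/-- An interpretation: a nonempty domain, interpretations of concept names
and of role names. -/
structure Interp where
  Δ : Type
  dom_nonempty : Nonempty Δ
  atom : ℕ → Set Δ
  rel : ℕ → Δ → Δ → Prop

def Role.sem (I : Interp) : Role → (I.Δ → I.Δ → Prop)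
  | .name R => I.rel R
  | .inv R  => fun d e => I.rel R e d

def Concept.sem (I : Interp) : Concept → Set I.Δ
  | .atom A => I.atom A
  | .top => Set.univ
  | .bot => ∅
  | .and C D => C.sem I ∩ D.sem I
  | .or C D => C.sem I ∪ D.sem I
  | .neg C => (C.sem I)ᶜ
  | .ex S C => {d | ∃ e, S.sem I d e ∧ e ∈ C.sem I}
  | .all S C => {d | ∀ e, S.sem I d e → e ∈ C.sem I}
  | .atLeast k S C => {d | ∃ s : Finset I.Δ, s.card = k ∧ ∀ e ∈ s, S.sem I d e ∧ e ∈ C.sem I}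

/-! ### Concept languages L(Os)[SC, SR] -/

def Role.inSig (Os : Finset Op) (SR : Finset ℕ) : Role → Prop
  | .name R => R ∈ SR
  | .inv R  => Op.inv ∈ Os ∧ R ∈ SR

/-- Membership of a concept in the language `L(Os)[SC, SR]`. -/
def Concept.inLang (Os : Finset Op) (SC SR : Finset ℕ) : Concept → Prop
  | .atom A => A ∈ SC
  | .top => Op.top ∈ Os
  | .bot => Op.bot ∈ Os
  | .and C D => Op.and ∈ Os ∧ C.inLang Os SC SR ∧ D.inLang Os SC SR
  | .or C D => Op.or ∈ Os ∧ C.inLang Os SC SR ∧ D.inLang Os SC SR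
  | .neg C => Op.neg ∈ Os ∧ C.inLang Os SC SR
  | .ex S C => Op.ex ∈ Os ∧ S.inSig Os SR ∧ C.inLang Os SC SR
  | .all S C => Op.all ∈ Os ∧ S.inSig Os SR ∧ C.inLang Os SC SR
  | .atLeast k S C => Op.ge ∈ Os ∧ 1 ≤ k ∧ S.inSig Os SR ∧ C.inLang Os SC SR

/-! ### DL-Lite ontologies -/

/-- Basic concepts: concept names, ∃R and ∃R⁻. -/
inductive Basic where
  | atom : ℕ → Basic
  | ex : Role → Basic
deriving DecidableEq

def Basic.sem (I : Interp) : Basic → Set I.Δ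
  | .atom A => I.atom A
  | .ex S => {d | ∃ e, S.sem I d e}

/-- A DL-Lite concept inclusion `B ⊑ C` where `C` is a basic concept
(`negated = false`) or a negated basic concept (`negated = true`). -/
structure CI where
  lhs : Basic
  rhs : Basic
  negated : Bool
deriving DecidableEq

def CI.sat (I : Interp) (ci : CI) : Prop :=
  if ci.negated then ci.lhs.sem I ⊆ (ci.rhs.sem I)ᶜ else ci.lhs.sem I ⊆ ci.rhs.sem I

/-- A DL-Lite ontology: a finite set (list) of concept inclusions. -/
abbrev Ontology := List CI

def Interp.satO (I : Interp) (Ont : Ontology) : Prop := ∀ ci ∈ Ont, ci.sat I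

/-! ### Pointed interpretations, examples, characterisations -/

structure PInterp where
  I : Interp
  pt : I.Δ

/-- A pointed interpretation is finite if its domain is finite. -/
def PInterp.finite (P : PInterp) : Prop := Finite P.I.Δ

/-- `C` fits a collection `(Epos, Eneg)` of labelled examples. -/
def Fits (C : Concept) (Epos Eneg : List PInterp) : Prop :=
  (∀ e ∈ Epos, e.pt ∈ C.sem e.I) ∧ (∀ e ∈ Eneg, e.pt ∉ C.sem e.I)

/-- Equivalence of concepts. -/
def CEquiv (C D : Concept) : Prop := ∀ I : Interp, C.sem I = D.sem I

/-- Equivalence of concepts relative to an ontology. -/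
def CEquivO (Ont : Ontology) (C D : Concept) : Prop :=
  ∀ I : Interp, I.satO Ont → C.sem I = D.sem I

/-- `⊨ C ⊑ D`. -/
def Subsumes (C D : Concept) : Prop := ∀ I : Interp, C.sem I ⊆ D.sem I

/-- `Ont ⊨ C ⊑ D`. -/
def SubsumesO (Ont : Ontology) (C D : Concept) : Prop :=
  ∀ I : Interp, I.satO Ont → C.sem I ⊆ D.sem I

/-- `(Epos, Eneg)` is a finite characterisation of `C` w.r.t. the
concept language (predicate) `L`: all examples are finite, `C` fits,
and every fitting concept of `L` is equivalent to `C`. -/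
def FinChar (L : Concept → Prop) (C : Concept) (Epos Eneg : List PInterp) : Prop :=
  (∀ e ∈ Epos ++ Eneg, e.finite) ∧
  Fits C Epos Eneg ∧
  ∀ D, L D → Fits D Epos Eneg → CEquiv C D

/-- Finite characterisation of `C` w.r.t. `L` under an ontology `Ont`:
all examples are finite and satisfy `Ont`, `C` fits, and every fitting
concept of `L` is equivalent to `C` relative to `Ont`. -/
def FinCharO (Ont : Ontology) (L : Concept → Prop) (C : Concept)
    (Epos Eneg : List PInterp) : Prop :=
  (∀ e ∈ Epos ++ Eneg, e.finite ∧ e.I.satO Ont) ∧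
  Fits C Epos Eneg ∧
  ∀ D, L D → Fits D Epos Eneg → CEquivO Ont C D

/-- `L(Os)` admits finite characterisations. -/
def AdmitsFinChar (Os : Finset Op) : Prop :=
  ∀ SC SR : Finset ℕ, ∀ C : Concept, C.inLang Os SC SR →
    ∃ Epos Eneg : List PInterp, FinChar (Concept.inLang Os SC SR) C Epos Eneg

/-- `L(Os)` admits finite characterisations under the ontology `Ont`. -/
def AdmitsFinCharO (Os : Finset Op) (Ont : Ontology) : Prop :=
  ∀ SC SR : Finset ℕ, ∀ C : Concept, C.inLang Os SC SR →
    ∃ Epos Eneg : List PInterp, FinCharO Ont (Concept.inLang Os SC SR) C Epos Eneg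

/-! ### Size, role depth, number restrictions -/

/-- Number of symbols of a concept expression (numbers in binary). -/
def Concept.size : Concept → ℕ
  | .atom _ => 1
  | .top => 1
  | .bot => 1
  | .and C D => C.size + D.size + 1
  | .or C D => C.size + D.size + 1
  | .neg C => C.size + 1
  | .ex _ C => C.size + 2
  | .all _ C => C.size + 2
  | .atLeast k _ C => C.size + 2 + Nat.size k

/-- Role depth of a concept. -/
def Concept.dp : Concept → ℕ
  | .atom _ => 0
  | .top => 0
  | .bot => 0
  | .and C D => max C.dp D.dp
  | .or C D => max C.dp D.dp
  | .neg C => C.dp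
  | .ex _ C => C.dp + 1
  | .all _ C => C.dp + 1
  | .atLeast _ _ C => C.dp + 1

/-- The largest number occurring in a number restriction of `C` (0 if none). -/
def Concept.nr : Concept → ℕ
  | .atom _ => 0
  | .top => 0
  | .bot => 0
  | .and C D => max C.nr D.nr
  | .or C D => max C.nr D.nr
  | .neg C => C.nr
  | .ex _ C => C.nr
  | .all _ C => C.nr
  | .atLeast k _ C => max k C.nr

/-- The operator set of `L(≥,⊓,⊤)`. -/
def ELQops : Finset Op := {Op.ge, Op.and, Op.top}

/-- The restriction of an interpretation to a nonempty set of elements. -/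
def Interp.restrict (I : Interp) (T : Set I.Δ) (hT : T.Nonempty) : Interp where
  Δ := T
  dom_nonempty := hT.to_subtype
  atom A := {x | x.1 ∈ I.atom A}
  rel R x y := I.rel R x.1 y.1

theorem Role.sem_restrict (S : Role) (I : Interp) (T : Set I.Δ) (hT : T.Nonempty)
    (x y : (I.restrict T hT).Δ) : S.sem (I.restrict T hT) x y ↔ S.sem I x.1 y.1 := by
  cases S <;> rfl

theorem Concept.size_pos (C : Concept) : 0 < C.size := by
  cases C <;> simp [Concept.size]

theorem pow_self_add_pow_self_le (a b : ℕ) (ha : 0 < a) (hb : 0 < b) :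
    a ^ a + b ^ b ≤ (a + b + 1) ^ (a + b + 1) := by
  have h₁ : a ^ a ≤ (a + b + 1) ^ (a + b) :=
    (Nat.pow_le_pow_left (by omega) _).trans (Nat.pow_le_pow_right (by omega) (by omega))
  have h₂ : b ^ b ≤ (a + b + 1) ^ (a + b) :=
    (Nat.pow_le_pow_left (by omega) _).trans (Nat.pow_le_pow_right (by omega) (by omega))
  have h₃ : (a + b + 1) ^ (a + b) * 2 ≤ (a + b + 1) ^ (a + b) * (a + b + 1) :=
    Nat.mul_le_mul_left _ (by omega)
  rw [pow_succ]
  omega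

theorem mul_pow_self_succ_le (k n : ℕ) (hn : 0 < n) :
    k * n ^ n + 1 ≤ (n + 2 + k.size) ^ (n + 2 + k.size) := by
  have hpos : 1 ≤ n ^ n := Nat.one_le_pow _ _ hn
  calc k * n ^ n + 1 ≤ (k + 1) * n ^ n := by rw [add_mul, one_mul]; omega
    _ ≤ 2 ^ k.size * n ^ n := Nat.mul_le_mul_right _ (Nat.lt_size_self k)
    _ ≤ (n + 2 + k.size) ^ k.size * (n + 2 + k.size) ^ n := by gcongr <;> omega
    _ = (n + 2 + k.size) ^ (k.size + n) := (pow_add _ _ _).symm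
    _ ≤ (n + 2 + k.size) ^ (n + 2 + k.size) := Nat.pow_le_pow_right (by omega) (by omega)

open Classical in
/-- A concept of `L(≥,⊓,⊤)` true at `d` has a small set of elements such that the concept
stays true at `d` in every restriction to a superset. -/
theorem exists_witness_finset (SC SR : Finset ℕ) (C : Concept) (hC : C.inLang ELQops SC SR)
    (I : Interp) (d : I.Δ) (hd : d ∈ C.sem I) :
    ∃ S : Finset I.Δ, d ∈ S ∧ S.card ≤ C.size ^ C.size ∧
      ∀ (T : Set I.Δ) (hT : T.Nonempty) (hdT : d ∈ T), ↑S ⊆ T →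
        (⟨d, hdT⟩ : T) ∈ C.sem (I.restrict T hT) := by
  induction C generalizing d with
  | atom A => exact ⟨{d}, by simp, by simp [Concept.size], fun _ _ _ _ => hd⟩
  | top => exact ⟨{d}, by simp, by simp [Concept.size], fun _ _ _ _ => trivial⟩
  | and C D ihC ihD =>
    obtain ⟨S₁, hdS, hc₁, h₁⟩ := ihC hC.2.1 d hd.1
    obtain ⟨S₂, -, hc₂, h₂⟩ := ihD hC.2.2 d hd.2
    refine ⟨S₁ ∪ S₂, Finset.mem_union_left _ hdS, ?_, fun T hT hdT hST => ?_⟩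
    · exact (Finset.card_union_le _ _).trans ((Nat.add_le_add hc₁ hc₂).trans
        (pow_self_add_pow_self_le _ _ C.size_pos D.size_pos))
    · rw [Finset.coe_union, Set.union_subset_iff] at hST
      exact ⟨h₁ T hT hdT hST.1, h₂ T hT hdT hST.2⟩
  | atLeast k R C ih =>
    obtain ⟨s, rfl, hs⟩ := hd
    choose! W hmem hcard hW using fun e (he : e ∈ s) => ih hC.2.2.2 e (hs e he).2
    refine ⟨insert d (s.biUnion W), Finset.mem_insert_self _ _, ?_, fun T hT hdT hST => ?_⟩
    · exact (Finset.card_insert_le _ _).trans ((Nat.add_le_add_right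
        (Finset.card_biUnion_le_card_mul _ _ _ hcard) 1).trans
        (mul_pow_self_succ_le _ _ C.size_pos))
    · have hWT : ∀ e ∈ s, ↑(W e) ⊆ T := fun e he x hx =>
        hST (Finset.mem_insert_of_mem (Finset.mem_biUnion.2 ⟨e, he, hx⟩))
      refine ⟨s.subtype (· ∈ T), ?_, fun e he => ?_⟩
      · exact (Finset.card_subtype _ _).trans
          (congrArg _ (Finset.filter_true_of_mem fun e he => hWT e he (hmem e he)))
      · have hes : e.1 ∈ s := Finset.mem_subtype.1 he
        exact ⟨(R.sem_restrict I T hT _ _).2 (hs _ hes).1, hW _ hes T hT e.2 (hWT _ hes)⟩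
  | _ => simp [Concept.inLang, ELQops] at hC

/-- **Lemma (small sub-interpretations)**: for every `C ∈ L(≥,⊓,⊤)[SC,SR]`,
every interpretation `I` and every `d ∈ C^I`, there is a sub-interpretation
`J ⊆ I` (given by an injection `f` preserving concept-name and role
memberships) containing `d`, satisfying `C` at `d`, of size at most
`|C|^|C|`. -/
theorem small_subinterpretation (SC SR : Finset ℕ) (C : Concept)
    (hC : C.inLang ELQops SC SR)
    (I : Interp) (d : I.Δ) (hd : d ∈ C.sem I) :
    ∃ (J : Interp) (f : J.Δ → I.Δ),
      Function.Injective f ∧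
      (∀ A : ℕ, ∀ a : J.Δ, a ∈ J.atom A → f a ∈ I.atom A) ∧
      (∀ R : ℕ, ∀ a b : J.Δ, J.rel R a b → I.rel R (f a) (f b)) ∧
      Finite J.Δ ∧ Nat.card J.Δ ≤ C.size ^ C.size ∧
      ∃ d₀ : J.Δ, f d₀ = d ∧ d₀ ∈ C.sem J := by
  obtain ⟨S, hdS, hcard, h⟩ := exists_witness_finset SC SR C hC I d hd
  refine ⟨I.restrict S ⟨d, hdS⟩, Subtype.val, Subtype.val_injective, fun _ _ ha => ha,
    fun _ _ _ hab => hab, S.finite_toSet, ?_, ⟨d, hdS⟩, rfl, h S ⟨d, hdS⟩ hdS subset_rfl⟩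
  change Nat.card (S : Set I.Δ) ≤ _
  simpa using hcard

end DL
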